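/- The new smoothing function s₃^{#}(r) = erf(r) − (2/9)·r·(9 + 6r² − 4r⁴)·e^{−r²}/√π factors to fifth order through an analytic function: there exists a function g : ℝ → ℝ that is real-analytic on all of ℝ such that s₃^{#}(r) = r⁵ · g(r) for every real r. -/

import Mathlib

open MeasureTheory Real Filter

/-- The error function `erf(r) = (2/√π) ∫₀^r e^{−t²} dt`. -/
noncomputable def erf (r : ℝ) : ℝ :=
  (2 / Real.sqrt Real.pi) * ∫ t in (0:ℝ)..r, Real.exp (-t ^ 2)

/-- The new smoothing function `s₃^{#}(r) = erf(r) − (2/9)r(9 + 6r² − 4r⁴)e^{−r²}/√π`. -/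
noncomputable def s3SharpNew (r : ℝ) : ℝ :=
  erf r - (2 / 9) * r * (9 + 6 * r ^ 2 - 4 * r ^ 4) * Real.exp (-r ^ 2) / Real.sqrt Real.pi

theorem hasDerivAt_erf (r : ℝ) :
    HasDerivAt erf (2 / Real.sqrt Real.pi * Real.exp (-r ^ 2)) r := by
  have hc : Continuous fun t : ℝ => Real.exp (-t ^ 2) := by fun_prop
  exact (hc.integral_hasStrictDerivAt 0 r).hasDerivAt.const_mul _

theorem analyticAt_erf (x : ℝ) : AnalyticAt ℝ erf x := by
  have hd : Differentiable ℂ fun z : ℂ => Complex.exp (-z ^ 2) := by fun_prop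
  obtain ⟨F, hF⟩ := hd.isExactOn_univ
  have hFd : Differentiable ℂ F := fun z => (hF z (Set.mem_univ z)).differentiableAt
  have hderiv (t : ℝ) :
      HasDerivAt (fun s : ℝ => (F s).re) (Real.exp (-t ^ 2)) t := by
    convert (hF t (Set.mem_univ _)).real_of_complex using 1
    rw [← Complex.exp_ofReal_re]
    push_cast
    rfl
  have herf : erf = fun r : ℝ => 2 / Real.sqrt Real.pi * ((F r).re - (F (0 : ℝ)).re) := by
    funext r
    rw [erf, intervalIntegral.integral_eq_sub_of_hasDerivAt (fun t _ => hderiv t)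
      (Continuous.intervalIntegrable (by fun_prop) _ _)]
  rw [herf]
  have hre : AnalyticAt ℝ (fun r : ℝ => (F r).re) x := (hFd.analyticAt _).re_ofReal
  fun_prop

theorem analyticAt_s3SharpNew (x : ℝ) : AnalyticAt ℝ s3SharpNew x := by
  have h := analyticAt_erf x
  unfold s3SharpNew
  simp only [div_eq_mul_inv]
  fun_prop

theorem hasDerivAt_s3SharpNew (r : ℝ) :
    HasDerivAt s3SharpNew
      (r ^ 4 * ((64 / 9 - 16 / 9 * r ^ 2) * Real.exp (-r ^ 2) / Real.sqrt Real.pi)) r := by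
  have hp : HasDerivAt (fun r : ℝ => 2 / 9 * r * (9 + 6 * r ^ 2 - 4 * r ^ 4))
      (2 + 4 * r ^ 2 - 40 / 9 * r ^ 4) r := by
    refine (((hasDerivAt_id' r).const_mul (2 / 9)).mul
      ((((hasDerivAt_pow 2 r).const_mul 6).const_add 9).sub
        ((hasDerivAt_pow 4 r).const_mul 4))).congr_deriv ?_
    simp only [Pi.sub_apply]
    push_cast
    ring
  have he : HasDerivAt (fun r : ℝ => Real.exp (-r ^ 2)) (Real.exp (-r ^ 2) * -(2 * r)) r := by
    simpa using (hasDerivAt_pow 2 r).fun_neg.exp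
  refine ((hasDerivAt_erf r).sub ((hp.mul he).div_const (Real.sqrt Real.pi))).congr_deriv ?_
  ring

theorem s3SharpNew_zero : s3SharpNew 0 = 0 := by
  simp [s3SharpNew, erf]

theorem five_le_analyticOrderAt_s3SharpNew : (5 : ℕ) ≤ analyticOrderAt s3SharpNew 0 := by
  have hderiv : (4 : ℕ) ≤ analyticOrderAt (deriv s3SharpNew) 0 := by
    rw [natCast_le_analyticOrderAt (analyticAt_s3SharpNew 0).deriv]
    refine ⟨fun r => (64 / 9 - 16 / 9 * r ^ 2) * Real.exp (-r ^ 2) / Real.sqrt Real.pi, ?_,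
      Eventually.of_forall fun r => ?_⟩
    · simp only [div_eq_mul_inv]
      fun_prop
    · rw [(hasDerivAt_s3SharpNew r).deriv, sub_zero, smul_eq_mul]
  have h := (analyticAt_s3SharpNew 0).analyticOrderAt_deriv_add_one
  simp only [s3SharpNew_zero, sub_zero] at h
  rw [← h]
  exact add_le_add_left hderiv 1

/-- A globally analytic function vanishing to order at least `n` at `0` is `r ^ n` times a
globally analytic function. -/
theorem exists_analytic_eq_pow_mul {f : ℝ → ℝ} (hf : ∀ x, AnalyticAt ℝ f x) {n : ℕ}
    (hn : n ≤ analyticOrderAt f 0) :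
    ∃ g : ℝ → ℝ, (∀ x, AnalyticAt ℝ g x) ∧ ∀ r, f r = r ^ n * g r := by
  classical
  obtain ⟨g₀, hg₀, hfg⟩ := (natCast_le_analyticOrderAt (hf 0)).1 hn
  simp only [sub_zero, smul_eq_mul] at hfg
  refine ⟨Function.update (fun r => f r / r ^ n) 0 (g₀ 0), fun x => ?_, fun r => ?_⟩
  · rcases eq_or_ne x 0 with rfl | hx
    · refine hg₀.congr ?_
      filter_upwards [hfg] with r hr
      rcases eq_or_ne r 0 with rfl | h0
      · simp
      · rw [Function.update_of_ne h0, hr, mul_div_cancel_left₀ _ (pow_ne_zero n h0)]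
    · have hq : AnalyticAt ℝ (fun r => f r / r ^ n) x :=
        (hf x).div (by fun_prop) (pow_ne_zero n hx)
      refine hq.congr ?_
      filter_upwards [isOpen_ne.mem_nhds hx] with r hr
      rw [Function.update_of_ne hr]
  · rcases eq_or_ne r 0 with rfl | h0
    · simpa using hfg.self_of_nhds
    · rw [Function.update_of_ne h0, mul_div_cancel₀ _ (pow_ne_zero n h0)]

/-- `s₃^{#}` vanishes to fifth order at `0` through a globally analytic factor:
there is a real-analytic `g : ℝ → ℝ` with `s₃^{#}(r) = r⁵ g(r)` for all `r`. -/
theorem s3SharpNew_factors_analytic :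
    ∃ g : ℝ → ℝ, (∀ x : ℝ, AnalyticAt ℝ g x) ∧ ∀ r : ℝ, s3SharpNew r = r ^ 5 * g r := by
  exact exists_analytic_eq_pow_mul analyticAt_s3SharpNew five_le_analyticOrderAt_s3SharpNew
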